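/- (Theorem 3, ℓ∞-rate of convergence, first inequality.) Let ϝ = ‖Γ⁻¹(E_n[x_ix_i'] − I)Γ⁻¹‖_∞ (the maximum absolute entry of the indicated p×p matrix). Let c > 1, and suppose λ/n ≥ c‖Γ⁻¹S̃‖_∞ and κ̃ > 0. Then any square-root lasso minimizer β̂ satisfies ‖Γ⁻¹(β̂ − β₀)‖_∞ ≤ ((1+c)/c)·(λ/n)·√Q̂(β₀) + (λ²/n²)·(√s/κ̃)·‖β̂ − β₀‖_{2,n} + ϝ·‖Γ(β̂ − β₀)‖₁. -/

import Mathlib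

open Finset MeasureTheory ProbabilityTheory

namespace SqrtLasso

/-- Empirical average `E_n[h_i] = n⁻¹ ∑ᵢ h i`. -/
noncomputable def En (n : ℕ) (h : Fin n → ℝ) : ℝ := (∑ i, h i) / n

/-- Euclidean inner product `a'b = ∑ⱼ aⱼ bⱼ`. -/
noncomputable def dot {p : ℕ} (a b : Fin p → ℝ) : ℝ := ∑ j, a j * b j

/-- Prediction norm `‖δ‖_{2,n} = (E_n[(x_i'δ)²])^{1/2}`. -/
noncomputable def predNorm (n : ℕ) {p : ℕ} (x : Fin n → Fin p → ℝ) (δ : Fin p → ℝ) : ℝ :=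
  Real.sqrt (En n fun i => (dot (x i) δ) ^ 2)

/-- `ℓ₁` norm of a vector. -/
noncomputable def l1 {p : ℕ} (v : Fin p → ℝ) : ℝ := ∑ j, |v j|

/-- Restriction `v_S`: equal to `v` on `S` and `0` outside. -/
def restr {p : ℕ} (S : Finset (Fin p)) (v : Fin p → ℝ) : Fin p → ℝ :=
  fun j => if j ∈ S then v j else 0

/-- `Γ v`, i.e. componentwise rescaling by loadings `γ`. -/
noncomputable def scl {p : ℕ} (γ v : Fin p → ℝ) : Fin p → ℝ := fun j => γ j * v j

/-- The support of a vector. -/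
noncomputable def supp {p : ℕ} (β : Fin p → ℝ) : Finset (Fin p) := Finset.univ.filter fun j => β j ≠ 0

/-- The least-squares criterion `Q̂(β) = E_n[(y_i - x_i'β)²]`. -/
noncomputable def Qhat (n : ℕ) {p : ℕ} (x : Fin n → Fin p → ℝ) (y : Fin n → ℝ)
    (β : Fin p → ℝ) : ℝ := En n fun i => (y i - dot (x i) β) ^ 2

/-- The restricted set `Δ_c̄`. -/
def Delta {p : ℕ} (γ : Fin p → ℝ) (T : Finset (Fin p)) (cb : ℝ) : Set (Fin p → ℝ) :=
  {δ | δ ≠ 0 ∧ l1 (scl γ (restr Tᶜ δ)) ≤ cb * l1 (scl γ (restr T δ))}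

/-- The restricted eigenvalue `κ_c̄`. -/
noncomputable def kappa (n : ℕ) {p : ℕ} (x : Fin n → Fin p → ℝ) (γ : Fin p → ℝ)
    (T : Finset (Fin p)) (cb : ℝ) : ℝ :=
  sInf {r | ∃ δ ∈ Delta γ T cb,
    r = Real.sqrt T.card * predNorm n x δ / l1 (scl γ (restr T δ))}

/-- The quantity `κ̃`. -/
noncomputable def kappaTilde (n : ℕ) {p : ℕ} (x : Fin n → Fin p → ℝ) (γ : Fin p → ℝ)
    (T : Finset (Fin p)) : ℝ :=
  sInf {r | ∃ δ : Fin p → ℝ, l1 (scl γ (restr Tᶜ δ)) < l1 (scl γ (restr T δ)) ∧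
    r = Real.sqrt T.card * predNorm n x δ /
      (l1 (scl γ (restr T δ)) - l1 (scl γ (restr Tᶜ δ)))}

/-- The score `S̃ = E_n[x_i(σε_i + r_i)] / √(E_n[(σε_i + r_i)²])`. -/
noncomputable def score (n : ℕ) {p : ℕ} (x : Fin n → Fin p → ℝ) (ε rr : Fin n → ℝ)
    (σ : ℝ) : Fin p → ℝ :=
  fun j => En n (fun i => x i j * (σ * ε i + rr i)) /
    Real.sqrt (En n fun i => (σ * ε i + rr i) ^ 2)

/-- `‖Γ⁻¹ S̃‖_∞ = max_j |S̃_j| / γ_j`. -/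
noncomputable def scoreSup (n : ℕ) {p : ℕ} (x : Fin n → Fin p → ℝ) (ε rr : Fin n → ℝ)
    (σ : ℝ) (γ : Fin p → ℝ) : ℝ :=
  ⨆ j, |score n x ε rr σ j| / γ j

/-- The quantity `ϱ_c̄`. -/
noncomputable def varrho (n : ℕ) {p : ℕ} (x : Fin n → Fin p → ℝ) (γ : Fin p → ℝ)
    (T : Finset (Fin p)) (β₀ : Fin p → ℝ) (S : Fin p → ℝ) (cb : ℝ) : ℝ :=
  sSup {r | ∃ δ ∈ Delta γ T cb, 0 < predNorm n x δ ∧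
    l1 (scl γ (δ + β₀)) ≤ cb * l1 (scl γ β₀) ∧ r = |dot S δ| / predNorm n x δ}

/-- Quadratic form `δ'Mδ`. -/
noncomputable def quadForm {p : ℕ} (M : Fin p → Fin p → ℝ) (δ : Fin p → ℝ) : ℝ :=
  ∑ j, ∑ k, δ j * M j k * δ k

/-- Maximal `m`-sparse eigenvalue `φ_max(m, M)`. -/
noncomputable def phiMax {p : ℕ} (M : Fin p → Fin p → ℝ) (T : Finset (Fin p)) (m : ℕ) : ℝ :=
  sSup {r | ∃ δ : Fin p → ℝ, δ ≠ 0 ∧ (supp δ \ T).card ≤ m ∧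
    r = quadForm M δ / ∑ j, (δ j) ^ 2}

/-- Minimal `m`-sparse eigenvalue `φ_min(m, M)`. -/
noncomputable def phiMin {p : ℕ} (M : Fin p → Fin p → ℝ) (T : Finset (Fin p)) (m : ℕ) : ℝ :=
  sInf {r | ∃ δ : Fin p → ℝ, δ ≠ 0 ∧ (supp δ \ T).card ≤ m ∧
    r = quadForm M δ / ∑ j, (δ j) ^ 2}

/-- Gram matrix `E_n[x_i x_i']`. -/
noncomputable def gram (n : ℕ) {p : ℕ} (x : Fin n → Fin p → ℝ) : Fin p → Fin p → ℝ :=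
  fun j k => En n fun i => x i j * x i k

/-- Rescaled Gram matrix `Γ⁻¹ E_n[x_i x_i'] Γ⁻¹`. -/
noncomputable def rgram (n : ℕ) {p : ℕ} (x : Fin n → Fin p → ℝ) (γ : Fin p → ℝ) :
    Fin p → Fin p → ℝ :=
  fun j k => gram n x j k / (γ j * γ k)

lemma opt_aux1 (q A B L : ℝ) (hq : 0 ≤ q) (hL : 0 < L)
    (hnn : ∀ t : ℝ, 0 ≤ q ^ 2 - 2 * t * A + t ^ 2 * B)
    (h : ∀ t : ℝ, q - L * |t| ≤ Real.sqrt (q ^ 2 - 2 * t * A + t ^ 2 * B)) :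
    A ≤ L * q := by
  have hB : B ≤ |B| := le_abs_self B
  have hB0 : 0 ≤ |B| := abs_nonneg B
  rcases hq.eq_or_lt with h0 | h0
  · subst h0
    by_contra hA
    push Not at hA
    have hA' : 0 < A := by simpa using hA
    have h1 := hnn (A / (|B| + 1))
    have ht : 0 < A / (|B| + 1) := by positivity
    have h2 : A / (|B| + 1) * (|B| + 1) = A := by field_simp
    set t := A / (|B| + 1)
    nlinarith [mul_pos ht hA', mul_pos ht ht, mul_le_mul_of_nonneg_left hB (mul_pos ht ht).le]
  · by_contra hA
    push Not at hA
    set d := A - L * q with hd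
    have hd0 : 0 < d := by linarith
    obtain ⟨t, ht, ht1, ht2⟩ : ∃ t : ℝ, 0 < t ∧ t ≤ q / L ∧ t ≤ d / (|B| + 1) :=
      ⟨min (q / L) (d / (|B| + 1)), lt_min (by positivity) (by positivity),
        min_le_left _ _, min_le_right _ _⟩
    rw [le_div_iff₀ hL] at ht1
    rw [le_div_iff₀ (by positivity)] at ht2
    have h1 := h t
    rw [abs_of_pos ht] at h1
    have h2 : (q - L * t) ^ 2 ≤ q ^ 2 - 2 * t * A + t ^ 2 * B := by
      have := pow_le_pow_left₀ (by linarith) h1 2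
      rwa [Real.sq_sqrt (hnn t)] at this
    have h3 : t * (2 * d) ≤ t * (t * B - t * L ^ 2) := by rw [hd]; nlinarith
    have h4 := le_of_mul_le_mul_left h3 ht
    nlinarith [mul_le_mul_of_nonneg_left hB ht.le, mul_pos ht (pow_pos hL 2)]

lemma opt_aux (q A B L : ℝ) (hq : 0 ≤ q) (hL : 0 < L)
    (hnn : ∀ t : ℝ, 0 ≤ q ^ 2 - 2 * t * A + t ^ 2 * B)
    (h : ∀ t : ℝ, q - L * |t| ≤ Real.sqrt (q ^ 2 - 2 * t * A + t ^ 2 * B)) :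
    |A| ≤ L * q := by
  rw [abs_le']
  refine ⟨opt_aux1 q A B L hq hL hnn h, opt_aux1 q (-A) B L hq hL ?_ ?_⟩
  · intro t
    have := hnn (-t)
    ring_nf at this ⊢
    exact this
  · intro t
    have := h (-t)
    rw [abs_neg] at this
    ring_nf at this ⊢
    exact this

lemma En_nonneg (n : ℕ) (h : Fin n → ℝ) (hh : ∀ i, 0 ≤ h i) : 0 ≤ En n h :=
  div_nonneg (Finset.sum_nonneg fun i _ => hh i) (Nat.cast_nonneg n)

lemma En_sub (n : ℕ) (f g : Fin n → ℝ) : En n (fun i => f i - g i) = En n f - En n g := by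
  simp [En, Finset.sum_sub_distrib, sub_div]

lemma En_add (n : ℕ) (f g : Fin n → ℝ) : En n (fun i => f i + g i) = En n f + En n g := by
  simp [En, Finset.sum_add_distrib, add_div]

lemma En_mul (n : ℕ) (a : ℝ) (f : Fin n → ℝ) : En n (fun i => a * f i) = a * En n f := by
  simp [En, ← Finset.mul_sum, mul_div_assoc]

lemma dot_update {p : ℕ} (a b : Fin p → ℝ) (j : Fin p) (t : ℝ) :
    dot a (b + Pi.single j t) = dot a b + t * a j := by
  simp [dot, mul_add, Finset.sum_add_distrib, Pi.single_apply, mul_comm]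

lemma dot_sub {p : ℕ} (a b d : Fin p → ℝ) : dot a (b - d) = dot a b - dot a d := by
  simp [dot, mul_sub]

lemma l1_update {p : ℕ} (γ b : Fin p → ℝ) (hγ : ∀ j, 1 ≤ γ j) (j : Fin p) (t : ℝ) :
    l1 (scl γ (b + Pi.single j t)) ≤ l1 (scl γ b) + γ j * |t| := by
  have h : γ j * |t| = ∑ k, γ k * |(Pi.single j t : Fin p → ℝ) k| := by
    rw [Finset.sum_eq_single j] <;> simp +contextual [Pi.single_apply]
  unfold l1 scl
  rw [h, ← Finset.sum_add_distrib]
  refine Finset.sum_le_sum fun k _ => ?_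
  have hk : 0 < γ k := lt_of_lt_of_le one_pos (hγ k)
  rw [abs_mul, abs_mul, abs_of_pos hk, ← mul_add]
  exact mul_le_mul_of_nonneg_left (abs_add_le _ _) hk.le

lemma Qhat_update (n : ℕ) {p : ℕ} (x : Fin n → Fin p → ℝ) (y : Fin n → ℝ)
    (b : Fin p → ℝ) (j : Fin p) (t : ℝ) :
    Qhat n x y (b + Pi.single j t) = Qhat n x y b
      - 2 * t * En n (fun i => x i j * (y i - dot (x i) b))
      + t ^ 2 * En n (fun i => x i j ^ 2) := by
  unfold Qhat
  rw [← En_mul, ← En_mul, ← En_sub, ← En_add]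
  congr 1
  funext i
  rw [dot_update]
  ring

lemma first_order (n : ℕ) {p : ℕ} (x : Fin n → Fin p → ℝ) (y : Fin n → ℝ)
    (γ βh : Fin p → ℝ) (hγ : ∀ j, 1 ≤ γ j) (l : ℝ) (hl : 0 < l)
    (hmin : ∀ β : Fin p → ℝ,
      Real.sqrt (Qhat n x y βh) + l * l1 (scl γ βh) ≤
        Real.sqrt (Qhat n x y β) + l * l1 (scl γ β)) (j : Fin p) :
    |En n (fun i => x i j * (y i - dot (x i) βh))| ≤ l * γ j * Real.sqrt (Qhat n x y βh) := by
  have hQ : ∀ b, 0 ≤ Qhat n x y b := fun b => En_nonneg n _ fun i => sq_nonneg _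
  have hj : 0 < γ j := lt_of_lt_of_le one_pos (hγ j)
  refine opt_aux _ _ (En n (fun i => x i j ^ 2)) _ (Real.sqrt_nonneg _) (by positivity) ?_ ?_
  · intro t
    rw [Real.sq_sqrt (hQ _), ← Qhat_update]
    exact hQ _
  · intro t
    rw [Real.sq_sqrt (hQ _), ← Qhat_update]
    have h1 := hmin (βh + Pi.single j t)
    have h2 := mul_le_mul_of_nonneg_left (l1_update γ βh hγ j t) hl.le
    linarith

lemma cone (p : ℕ) (β₀ γ βh : Fin p → ℝ) (hγ : ∀ j, 1 ≤ γ j) :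
    l1 (scl γ β₀) - l1 (scl γ βh) ≤ l1 (scl γ (restr (supp β₀) (βh - β₀)))
      - l1 (scl γ (restr (supp β₀)ᶜ (βh - β₀))) := by
  unfold l1 scl
  rw [← Finset.sum_sub_distrib, ← Finset.sum_sub_distrib]
  refine Finset.sum_le_sum fun k _ => ?_
  have hk : 0 < γ k := lt_of_lt_of_le one_pos (hγ k)
  simp only [abs_mul, abs_of_pos hk, ← mul_sub]
  refine mul_le_mul_of_nonneg_left ?_ hk.le
  by_cases h : β₀ k = 0
  · simp [restr, supp, h]
  · simp only [restr, supp, Finset.mem_filter, Finset.mem_univ, true_and, Finset.mem_compl, h,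
      ne_eq, not_false_eq_true, not_true_eq_false, if_true, if_false, abs_zero, sub_zero,
      Pi.sub_apply]
    rw [abs_sub_comm]
    exact abs_sub_abs_le_abs_sub _ _

lemma kappa_bound (n p : ℕ) (x : Fin n → Fin p → ℝ) (γ : Fin p → ℝ) (T : Finset (Fin p))
    (hκ : 0 < kappaTilde n x γ T) (δ : Fin p → ℝ) :
    l1 (scl γ (restr T δ)) - l1 (scl γ (restr Tᶜ δ)) ≤
      Real.sqrt T.card / kappaTilde n x γ T * predNorm n x δ := by
  have hp : 0 ≤ predNorm n x δ := Real.sqrt_nonneg _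
  by_cases h : l1 (scl γ (restr Tᶜ δ)) < l1 (scl γ (restr T δ))
  · have h1 : kappaTilde n x γ T ≤ Real.sqrt T.card * predNorm n x δ /
      (l1 (scl γ (restr T δ)) - l1 (scl γ (restr Tᶜ δ))) := by
      refine csInf_le ⟨0, ?_⟩ ⟨δ, h, rfl⟩
      rintro r ⟨d, hd, rfl⟩
      exact div_nonneg (mul_nonneg (Real.sqrt_nonneg _) (Real.sqrt_nonneg _)) (by linarith)
    rw [le_div_iff₀ (by linarith)] at h1
    rw [div_mul_eq_mul_div, le_div_iff₀ hκ]
    linarith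
  · have : 0 ≤ Real.sqrt T.card / kappaTilde n x γ T * predNorm n x δ := by positivity
    linarith

lemma gram_apply (n p : ℕ) (x : Fin n → Fin p → ℝ) (δ : Fin p → ℝ) (j : Fin p) :
    ∑ k, gram n x j k * δ k = En n fun i => x i j * dot (x i) δ := by
  simp only [gram, En, dot, div_mul_eq_mul_div, Finset.sum_mul, Finset.mul_sum]
  rw [← Finset.sum_div, Finset.sum_comm]
  congr 1
  refine Finset.sum_congr rfl fun i _ => Finset.sum_congr rfl fun k _ => by ring

/-- Theorem 3, ℓ∞-rate of convergence, first inequality. -/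
theorem statement_7 (n p : ℕ) (hn : 1 ≤ n) (hp : 1 ≤ p)
    (x : Fin n → Fin p → ℝ) (β₀ γ : Fin p → ℝ) (hγ : ∀ j, 1 ≤ γ j)
    (hs : 1 ≤ (supp β₀).card)
    (σ : ℝ) (hσ : 0 ≤ σ) (ε rr : Fin n → ℝ) (y : Fin n → ℝ)
    (hy : ∀ i, y i = dot (x i) β₀ + σ * ε i + rr i)
    (hQ : 0 < En n fun i => (σ * ε i + rr i) ^ 2)
    (lam : ℝ) (hlam : 0 < lam)
    (c : ℝ) (hc : 1 < c)
    (hdom : c * scoreSup n x ε rr σ γ ≤ lam / n)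
    (βh : Fin p → ℝ)
    (hmin : ∀ β : Fin p → ℝ,
      Real.sqrt (Qhat n x y βh) + lam / n * l1 (scl γ βh) ≤
        Real.sqrt (Qhat n x y β) + lam / n * l1 (scl γ β))
    (hκ : 0 < kappaTilde n x γ (supp β₀)) :
    (⨆ j, |βh j - β₀ j| / γ j) ≤
      (1 + c) / c * (lam / n) * Real.sqrt (Qhat n x y β₀) +
        lam ^ 2 / n ^ 2 *
          (Real.sqrt (supp β₀).card / kappaTilde n x γ (supp β₀)) *
          predNorm n x (βh - β₀) +
        (⨆ j, ⨆ k, |(gram n x j k - if j = k then (1 : ℝ) else 0) / (γ j * γ k)|) *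
          l1 (scl γ (βh - β₀)) := by
  have hn0 : (0 : ℝ) < n := by exact_mod_cast hn
  have hl : 0 < lam / n := by positivity
  have hc0 : 0 < c := by linarith
  haveI : Nonempty (Fin p) := ⟨⟨0, hp⟩⟩
  refine ciSup_le fun j => ?_
  have hj : 0 < γ j := lt_of_lt_of_le one_pos (hγ j)
  set F := ⨆ j, ⨆ k, |(gram n x j k - if j = k then (1 : ℝ) else 0) / (γ j * γ k)| with hF
  set δ := βh - β₀ with hδ
  have hQ0 : Qhat n x y β₀ = En n fun i => (σ * ε i + rr i) ^ 2 := by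
    unfold Qhat
    congr 1
    funext i
    rw [hy i]
    ring
  set q0 := Real.sqrt (Qhat n x y β₀) with hq0
  have hq0pos : 0 < q0 := by rw [hq0, hQ0]; exact Real.sqrt_pos.mpr hQ
  -- term 1
  have hFk : ∀ k, |(gram n x j k - if j = k then (1 : ℝ) else 0) / (γ j * γ k)| ≤ F := fun k =>
    (le_ciSup (f := fun k => |(gram n x j k - if j = k then (1 : ℝ) else 0) / (γ j * γ k)|)
      (Set.finite_range _).bddAbove k).trans
    (le_ciSup (f := fun j => ⨆ k, |(gram n x j k - if j = k then (1 : ℝ) else 0) / (γ j * γ k)|)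
      (Set.finite_range _).bddAbove j)
  have h1 : |(∑ k, gram n x j k * δ k) - δ j| / γ j ≤ F * l1 (scl γ δ) := by
    have e : ((∑ k, gram n x j k * δ k) - δ j) / γ j =
        ∑ k, (gram n x j k - if j = k then (1 : ℝ) else 0) / (γ j * γ k) * (γ k * δ k) := by
      have : δ j = ∑ k, (if j = k then (1 : ℝ) else 0) * δ k := by simp
      rw [this, ← Finset.sum_sub_distrib, Finset.sum_div]
      refine Finset.sum_congr rfl fun k _ => ?_
      have hk : γ k ≠ 0 := (lt_of_lt_of_le one_pos (hγ k)).ne'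
      field_simp
    rw [← abs_of_pos hj, ← abs_div, e]
    refine (Finset.abs_sum_le_sum_abs _ _).trans ?_
    unfold l1 scl
    rw [Finset.mul_sum]
    refine Finset.sum_le_sum fun k _ => ?_
    rw [abs_mul]
    exact mul_le_mul_of_nonneg_right (hFk k) (abs_nonneg _)
  -- term 2
  have h2 : |En n fun i => x i j * (σ * ε i + rr i)| / γ j ≤ lam / n / c * q0 := by
    have hs1 : |score n x ε rr σ j| / γ j ≤ scoreSup n x ε rr σ γ :=
      le_ciSup (f := fun j => |score n x ε rr σ j| / γ j) (Set.finite_range _).bddAbove j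
    have hs2 : scoreSup n x ε rr σ γ ≤ lam / n / c := by
      rw [le_div_iff₀ hc0]; linarith
    have hs3 := mul_le_mul_of_nonneg_right (hs1.trans hs2) hq0pos.le
    refine le_trans (le_of_eq ?_) hs3
    unfold score
    rw [← hQ0, ← hq0, abs_div, abs_of_pos hq0pos]
    field_simp
  -- term 3
  have h3 := first_order n x y γ βh hγ _ hl hmin j
  have h4 : Real.sqrt (Qhat n x y βh) ≤
      q0 + lam / n * (Real.sqrt (supp β₀).card / kappaTilde n x γ (supp β₀) * predNorm n x δ) := by
    have a := hmin β₀
    have b := mul_le_mul_of_nonneg_left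
      ((cone p β₀ γ βh hγ).trans (kappa_bound n p x γ _ hκ (βh - β₀))) hl.le
    linarith
  have h5 : |En n (fun i => x i j * (y i - dot (x i) βh))| / γ j ≤ lam / n * (q0 +
      lam / n * (Real.sqrt (supp β₀).card / kappaTilde n x γ (supp β₀) * predNorm n x δ)) := by
    rw [div_le_iff₀ hj]
    have := mul_le_mul_of_nonneg_left h4 (mul_pos hl hj).le
    linarith
  have h6 : ∑ k, gram n x j k * δ k = (En n fun i => x i j * (σ * ε i + rr i)) -
      En n (fun i => x i j * (y i - dot (x i) βh)) := by
    rw [gram_apply, ← En_sub]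
    congr 1
    funext i
    rw [hδ, dot_sub, hy i]
    ring
  have h7 : |βh j - β₀ j| ≤ |En n fun i => x i j * (σ * ε i + rr i)| +
      |En n (fun i => x i j * (y i - dot (x i) βh))| + |(∑ k, gram n x j k * δ k) - δ j| := by
    have : βh j - β₀ j = (En n fun i => x i j * (σ * ε i + rr i)) -
      En n (fun i => x i j * (y i - dot (x i) βh)) - ((∑ k, gram n x j k * δ k) - δ j) := by
      rw [← h6, hδ]; simp
    rw [this]
    exact (abs_sub _ _).trans (add_le_add_left (abs_sub _ _) _)
  have h8 := div_le_div_of_nonneg_right h7 hj.le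
  rw [add_div, add_div] at h8
  have h9 : (1 + c) / c * (lam / n) * q0 + lam ^ 2 / n ^ 2 *
      (Real.sqrt (supp β₀).card / kappaTilde n x γ (supp β₀)) * predNorm n x δ =
      lam / n / c * q0 + lam / n * (q0 +
      lam / n * (Real.sqrt (supp β₀).card / kappaTilde n x γ (supp β₀) * predNorm n x δ)) := by
    field_simp
    ring
  linarith
end SqrtLasso
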